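/- arXiv:1802.07792 — 4 statements merged into one kernel-verified Lean document; each statement's English description precedes it below -/
import Mathlib

section
/- Let χ/η < u/l < a/b be three reduced fractions in [0,1] (i.e., χ,u,a ≥ 0, η,l,b ≥ 1, gcd(χ,η) = gcd(u,l) = gcd(a,b) = 1, χ ≤ η, u ≤ l, a ≤ b, and χ/η < u/l < a/b as rationals). Then gcd(al − ub, aη − χb) = gcd(al − ub, uη − χl) = gcd(aη − χb, uη − χl). -/
theorem IsCoprime.dvd_of_dvd_mul_of_dvd_mul {R : Type*} [CommRing R] {x y d r : R}
    (h : IsCoprime x y) (hx : d ∣ x * r) (hy : d ∣ y * r) : d ∣ r := by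
  obtain ⟨s, t, hst⟩ := h
  have hr : r = s * (x * r) + t * (y * r) := by linear_combination -r * hst
  rw [hr]
  exact dvd_add (hx.mul_left s) (hy.mul_left t)

/-- For three reduced fractions χ/η < u/l < a/b in [0,1],
the pairwise gcds of the three 2×2 determinants coincide. -/
theorem stmt_0 (χ η u l a b : ℕ)
    (hη : 1 ≤ η) (hl : 1 ≤ l) (hb : 1 ≤ b)
    (hχη : χ ≤ η) (hul : u ≤ l) (hab : a ≤ b)
    (g1 : Nat.gcd χ η = 1) (g2 : Nat.gcd u l = 1) (g3 : Nat.gcd a b = 1)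
    (h1 : (χ : ℚ) / η < (u : ℚ) / l) (h2 : (u : ℚ) / l < (a : ℚ) / b) :
    Int.gcd ((a : ℤ) * l - u * b) ((a : ℤ) * η - χ * b)
        = Int.gcd ((a : ℤ) * l - u * b) ((u : ℤ) * η - χ * l) ∧
    Int.gcd ((a : ℤ) * l - u * b) ((u : ℤ) * η - χ * l)
        = Int.gcd ((a : ℤ) * η - χ * b) ((u : ℤ) * η - χ * l) := by
  have c1 : IsCoprime (χ : ℤ) η := Nat.isCoprime_iff_coprime.mpr g1
  have c2 : IsCoprime (u : ℤ) l := Nat.isCoprime_iff_coprime.mpr g2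
  have c3 : IsCoprime (a : ℤ) b := Nat.isCoprime_iff_coprime.mpr g3
  set P : ℤ := (a : ℤ) * l - u * b with hP
  set Q : ℤ := (a : ℤ) * η - χ * b with hQ
  set R : ℤ := (u : ℤ) * η - χ * l with hR
  have dvd_R (d : ℤ) (dP : d ∣ P) (dQ : d ∣ Q) : d ∣ R := by
    refine c3.dvd_of_dvd_mul_of_dvd_mul ?_ ?_
    · rw [show (a : ℤ) * R = u * Q - χ * P by rw [hP, hQ, hR]; ring]
      exact dvd_sub (dQ.mul_left _) (dP.mul_left _)
    · rw [show (b : ℤ) * R = l * Q - η * P by rw [hP, hQ, hR]; ring]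
      exact dvd_sub (dQ.mul_left _) (dP.mul_left _)
  have dvd_Q (d : ℤ) (dP : d ∣ P) (dR : d ∣ R) : d ∣ Q := by
    refine c2.dvd_of_dvd_mul_of_dvd_mul ?_ ?_
    · rw [show (u : ℤ) * Q = a * R + χ * P by rw [hP, hQ, hR]; ring]
      exact dvd_add (dR.mul_left _) (dP.mul_left _)
    · rw [show (l : ℤ) * Q = b * R + η * P by rw [hP, hQ, hR]; ring]
      exact dvd_add (dR.mul_left _) (dP.mul_left _)
  have dvd_P (d : ℤ) (dQ : d ∣ Q) (dR : d ∣ R) : d ∣ P := by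
    refine c1.dvd_of_dvd_mul_of_dvd_mul ?_ ?_
    · rw [show (χ : ℤ) * P = u * Q - a * R by rw [hP, hQ, hR]; ring]
      exact dvd_sub (dQ.mul_left _) (dR.mul_left _)
    · rw [show (η : ℤ) * P = l * Q - b * R by rw [hP, hQ, hR]; ring]
      exact dvd_sub (dQ.mul_left _) (dR.mul_left _)
  constructor
  · refine Nat.dvd_antisymm (Int.dvd_gcd (Int.gcd_dvd_left _ _) ?_) (Int.dvd_gcd (Int.gcd_dvd_left _ _) ?_)
    · exact dvd_R _ (Int.gcd_dvd_left _ _) (Int.gcd_dvd_right _ _)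
    · exact dvd_Q _ (Int.gcd_dvd_left _ _) (Int.gcd_dvd_right _ _)
  · refine Nat.dvd_antisymm (Int.dvd_gcd ?_ (Int.gcd_dvd_right _ _)) (Int.dvd_gcd ?_ (Int.gcd_dvd_right _ _))
    · exact dvd_Q _ (Int.gcd_dvd_left _ _) (Int.gcd_dvd_right _ _)
    · exact dvd_P _ (Int.gcd_dvd_left _ _) (Int.gcd_dvd_right _ _)
end

section
/- Let (χ,η), (u,l), (a,b) be three pairs of nonnegative integers with η, l, b not all allowed to vanish in a ratio (each pair has a positive denominator or equals (1,0) with the convention that the ratio is +∞), such that gcd(χ,η) = gcd(u,l) = gcd(a,b) = 1 and χ/η < u/l < a/b as (extended) rationals. Then gcd(al − ub, aη − χb) = gcd(al − ub, uη − χl) = gcd(aη − χb, uη − χl). -/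
/-- A common divisor of `a * r` and `b * r` divides `r` when `a` and `b` are coprime. -/
theorem dvd_of_dvd_mul_of_coprime {a b : ℕ} (h : Nat.gcd a b = 1) {d r : ℤ}
    (ha : d ∣ a * r) (hb : d ∣ b * r) : d ∣ r := by
  obtain ⟨s, t, hst⟩ := Nat.isCoprime_iff_coprime.mpr h
  have hr : r = s * (a * r) + t * (b * r) := by linear_combination -r * hst
  rw [hr]
  exact dvd_add (ha.mul_left s) (hb.mul_left t)

/-- If a common divisor of any two of three integers divides the third,
then the pairwise gcds agree. -/
theorem pairwise_gcd_eq_of_dvd {p q r : ℤ}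
    (hr : ∀ d : ℤ, d ∣ p → d ∣ q → d ∣ r)
    (hq : ∀ d : ℤ, d ∣ p → d ∣ r → d ∣ q)
    (hp : ∀ d : ℤ, d ∣ q → d ∣ r → d ∣ p) :
    Int.gcd p q = Int.gcd p r ∧ Int.gcd p r = Int.gcd q r := by
  have hpq_p := Int.gcd_dvd_left p q
  have hpq_q := Int.gcd_dvd_right p q
  have hpr_p := Int.gcd_dvd_left p r
  have hpr_r := Int.gcd_dvd_right p r
  have hqr_q := Int.gcd_dvd_left q r
  have hqr_r := Int.gcd_dvd_right q r
  constructor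
  · exact Nat.dvd_antisymm (Int.dvd_gcd hpq_p (hr _ hpq_p hpq_q))
      (Int.dvd_gcd hpr_p (hq _ hpr_p hpr_r))
  · exact Nat.dvd_antisymm (Int.dvd_gcd (hq _ hpr_p hpr_r) hpr_r)
      (Int.dvd_gcd (hp _ hqr_q hqr_r) hqr_r)

/-- Same gcd identity for three coprime pairs of nonnegative integers,
where each pair has a positive denominator or equals (1,0) (the formal fraction 1/0,
larger than every rational).  The extended ordering χ/η < u/l is expressed by
cross-multiplication χ·l < u·η, which is faithful for such pairs (in particular
p/q < 1/0 becomes p·0 < 1·q, i.e. 0 < q). -/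
theorem stmt_1 (χ η u l a b : ℕ)
    (hη : 1 ≤ η ∨ (χ, η) = (1, 0))
    (hl : 1 ≤ l ∨ (u, l) = (1, 0))
    (hb : 1 ≤ b ∨ (a, b) = (1, 0))
    (g1 : Nat.gcd χ η = 1) (g2 : Nat.gcd u l = 1) (g3 : Nat.gcd a b = 1)
    (h1 : χ * l < u * η) (h2 : u * b < a * l) :
    Int.gcd ((a : ℤ) * l - u * b) ((a : ℤ) * η - χ * b)
        = Int.gcd ((a : ℤ) * l - u * b) ((u : ℤ) * η - χ * l) ∧
    Int.gcd ((a : ℤ) * l - u * b) ((u : ℤ) * η - χ * l)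
        = Int.gcd ((a : ℤ) * η - χ * b) ((u : ℤ) * η - χ * l) := by
  set p : ℤ := (a : ℤ) * l - u * b with hp
  set q : ℤ := (a : ℤ) * η - χ * b with hq
  set r : ℤ := (u : ℤ) * η - χ * l with hr
  have e1 : (a : ℤ) * r - u * q + χ * p = 0 := by rw [hp, hq, hr]; ring
  have e2 : (b : ℤ) * r - l * q + η * p = 0 := by rw [hp, hq, hr]; ring
  refine pairwise_gcd_eq_of_dvd (fun d h h' => ?_) (fun d h h' => ?_) (fun d h h' => ?_)
  · refine dvd_of_dvd_mul_of_coprime g3 ?_ ?_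
    · rw [show (a : ℤ) * r = u * q - χ * p by linear_combination e1]
      exact dvd_sub (h'.mul_left _) (h.mul_left _)
    · rw [show (b : ℤ) * r = l * q - η * p by linear_combination e2]
      exact dvd_sub (h'.mul_left _) (h.mul_left _)
  · refine dvd_of_dvd_mul_of_coprime g2 ?_ ?_
    · rw [show (u : ℤ) * q = a * r + χ * p by linear_combination -e1]
      exact dvd_add (h'.mul_left _) (h.mul_left _)
    · rw [show (l : ℤ) * q = b * r + η * p by linear_combination -e2]
      exact dvd_add (h'.mul_left _) (h.mul_left _)
  · refine dvd_of_dvd_mul_of_coprime g1 ?_ ?_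
    · rw [show (χ : ℤ) * p = u * q - a * r by linear_combination e1]
      exact dvd_sub (h.mul_left _) (h'.mul_left _)
    · rw [show (η : ℤ) * p = l * q - b * r by linear_combination e2]
      exact dvd_sub (h.mul_left _) (h'.mul_left _)
end

section
/- Let χ, η, a, b be nonnegative integers with η ≥ 1, gcd(χ,η) = gcd(a,b) = 1, b ≤ η, χ ≤ η, |aη − bχ| = 1, and either a ≤ b or (a,b) = (1,0). Let i ≥ 1, let N be a positive multiple of η·i·(i+1), and let q be an integer with N/(η(i+1)) < q ≤ N/(ηi). Define F'_i = { h/k ∈ F_i : k(ηq+b) − ηh ≤ N }. If q < N/(ηi) or b = 0, then F'_i = F_i, and in particular |F'_i| = |F_i|. -/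
/-- The Farey sequence of order `N`, as the finite set of all rationals `h/k`
with `0 ≤ h ≤ k ≤ N`. -/
def farey (N : ℕ) : Finset ℚ :=
  (Finset.range (N + 1)).biUnion fun k => (Finset.range (k + 1)).image fun h : ℕ => (h : ℚ) / (k : ℚ)

theorem num_nonneg_and_den_le_of_mem_farey {n : ℕ} (hn : 1 ≤ n) {x : ℚ} (hx : x ∈ farey n) :
    0 ≤ x.num ∧ x.den ≤ n := by
  simp only [farey, Finset.mem_biUnion, Finset.mem_range, Finset.mem_image] at hx
  obtain ⟨k, hk, h, -, rfl⟩ := hx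
  refine ⟨Rat.num_nonneg.mpr (by positivity), ?_⟩
  rcases Nat.eq_zero_or_pos k with rfl | hk0
  · simpa using hn
  · have hdvd : (((h : ℚ) / (k : ℚ)).den : ℤ) ∣ (k : ℤ) := by
      simpa [Rat.divInt_eq_div] using Rat.den_dvd (h : ℤ) (k : ℤ)
    have := Nat.le_of_dvd hk0 (Int.natCast_dvd_natCast.mp hdvd)
    lia

/-- if `q < N/(ηi)` or `b = 0` then
`F'_i = { h/k ∈ F_i : k(ηq+b) − ηh ≤ N }` equals `F_i`, and in particular the
cardinalities agree. -/
theorem stmt_6 (χ η a b i N q : ℕ)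
    (hη : 1 ≤ η) (g1 : Nat.gcd χ η = 1) (g2 : Nat.gcd a b = 1)
    (hbη : b ≤ η) (hχη : χ ≤ η)
    (hdet : ((a : ℤ) * η - b * χ).natAbs = 1)
    (hab : a ≤ b ∨ (a = 1 ∧ b = 0))
    (hi : 1 ≤ i) (hN : 0 < N) (hdvd : η * i * (i + 1) ∣ N)
    (hq1 : (N : ℚ) / (η * (i + 1)) < q) (hq2 : (q : ℚ) ≤ (N : ℚ) / (η * i))
    (hcase : (q : ℚ) < (N : ℚ) / (η * i) ∨ b = 0) :
    ((farey i).filter fun x => (x.den : ℤ) * (η * q + b) - η * x.num ≤ N) = farey i ∧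
    ((farey i).filter fun x => (x.den : ℤ) * (η * q + b) - η * x.num ≤ N).card
      = (farey i).card := by
  have hpos : (0 : ℚ) < η * i := by positivity
  have key : i * (η * q + b) ≤ N := by
    rcases hcase with hlt | rfl
    · obtain ⟨m, rfl⟩ := hdvd
      have hq : q < (i + 1) * m := by
        rw [lt_div_iff₀ hpos] at hlt
        have hlt' : q * (η * i) < η * i * (i + 1) * m := by exact_mod_cast hlt
        exact Nat.lt_of_mul_lt_mul_left (a := η * i) (by linarith)
      calc i * (η * q + b) ≤ i * (η * q + η) := by gcongr
        _ = η * i * (q + 1) := by ring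
        _ ≤ η * i * ((i + 1) * m) := Nat.mul_le_mul_left _ hq
        _ = η * i * (i + 1) * m := by ring
    · rw [le_div_iff₀ hpos] at hq2
      have hq2' : q * (η * i) ≤ N := by exact_mod_cast hq2
      linarith
  have hfilter :
      ((farey i).filter fun x => (x.den : ℤ) * (η * q + b) - η * x.num ≤ N) = farey i := by
    refine Finset.filter_true_of_mem fun x hx => ?_
    obtain ⟨hnum, hden⟩ := num_nonneg_and_den_le_of_mem_farey hi hx
    have hmul : (x.den : ℤ) * (η * q + b) ≤ N := by
      exact_mod_cast (Nat.mul_le_mul_right _ hden).trans key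
    have : 0 ≤ (η : ℤ) * x.num := by positivity
    linarith
  exact ⟨hfilter, congrArg Finset.card hfilter⟩
end

section
/- There exists a constant C > 0 such that for every i_max ≥ 1, with N = lcm(1, 2, …, i_max), for every integer i with 1 ≤ i ≤ i_max and every integer q with N/(i+1) < q ≤ N/i, one has | I_N(1/q) − (3/π²)·N²/q | ≤ C·N. -/
/-- `I_N(x)`: the number of elements of `F_N` that are `≤ x`. -/
def fareyPos (N : ℕ) (x : ℚ) : ℕ := ((farey N).filter (· ≤ x)).card

/-- `lcm(1, 2, …, n)`. -/
def lcmUpTo (n : ℕ) : ℕ := (Finset.Icc 1 n).lcm id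

open Finset ArithmeticFunction

/-- Sums over factorizations of the integers up to `N` are sums under the hyperbola. -/
lemma sum_Ioc_sum_divisorsAntidiagonal {R : Type*} [AddCommMonoid R] (F : ℕ → ℕ → R) (N : ℕ) :
    ∑ n ∈ Ioc 0 N, ∑ x ∈ n.divisorsAntidiagonal, F x.1 x.2 =
      ∑ d ∈ Ioc 0 N, ∑ m ∈ Ioc 0 (N / d), F d m := by
  rw [sum_sigma', sum_sigma']
  refine sum_bij' (fun p _ => ⟨p.2.1, p.2.2⟩) (fun p _ => ⟨p.1 * p.2, (p.1, p.2)⟩) ?_ ?_ ?_ ?_ ?_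
  · rintro ⟨n, d, m⟩ h
    simp only [mem_sigma, mem_Ioc, Nat.mem_divisorsAntidiagonal] at h ⊢
    obtain ⟨⟨h0, hN⟩, rfl, -⟩ := h
    have hd : 0 < d := Nat.pos_of_ne_zero (left_ne_zero_of_mul h0.ne')
    have hm : 0 < m := Nat.pos_of_ne_zero (right_ne_zero_of_mul h0.ne')
    refine ⟨⟨hd, (Nat.le_mul_of_pos_right _ hm).trans hN⟩, hm, ?_⟩
    rw [Nat.le_div_iff_mul_le hd, mul_comm]
    exact hN
  · rintro ⟨d, m⟩ h
    simp only [mem_sigma, mem_Ioc, Nat.mem_divisorsAntidiagonal] at h ⊢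
    obtain ⟨⟨hd, -⟩, hm, hN⟩ := h
    rw [Nat.le_div_iff_mul_le hd, mul_comm] at hN
    have := Nat.mul_pos hd hm
    exact ⟨⟨this, hN⟩, trivial, this.ne'⟩
  · rintro ⟨n, d, m⟩ h
    simp only [mem_sigma, Nat.mem_divisorsAntidiagonal] at h
    obtain ⟨-, rfl, -⟩ := h
    rfl
  · intros; rfl
  · intros; rfl

lemma totient_eq_sum_moebius {n : ℕ} (hn : 0 < n) :
    (n.totient : ℝ) = ∑ x ∈ n.divisorsAntidiagonal, (moebius x.1 : ℝ) * x.2 := by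
  refine ((sum_eq_iff_sum_mul_moebius_eq (R := ℝ) (f := fun k => (k.totient : ℝ))
    (g := fun k => (k : ℝ))).1 ?_ n hn).symm
  intro k _
  exact_mod_cast Nat.sum_totient k

lemma abs_moebius_cast_le_one (d : ℕ) : |(moebius d : ℝ)| ≤ 1 := by
  exact_mod_cast abs_moebius_le_one (n := d)

lemma abs_sum_moebius_div_le (n : ℕ) :
    |∑ d ∈ Ioc 0 n, (moebius d : ℝ) / d| ≤ 2 := by
  rcases Nat.eq_zero_or_pos n with rfl | hn
  · simp
  have hfloor : ∑ d ∈ Ioc 0 n, (moebius d : ℝ) * ((n / d : ℕ) : ℝ) = 1 := by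
    have h := sum_Ioc_mul_zeta_eq_sum moebius n
    rw [moebius_mul_coe_zeta] at h
    have h1 : ∑ k ∈ Ioc 0 n, (1 : ArithmeticFunction ℤ) k = 1 := by
      simp [one_apply, Nat.one_le_iff_ne_zero, hn.ne']
    rw [h1] at h
    have := congrArg (Int.cast : ℤ → ℝ) h
    simpa only [Int.cast_sum, Int.cast_mul, Int.cast_natCast, Int.cast_one] using this.symm
  have hdiff : |∑ d ∈ Ioc 0 n, ((moebius d : ℝ) * (n / d) - moebius d * ((n / d : ℕ) : ℝ))| ≤ n := by
    refine (abs_sum_le_sum_abs _ _).trans ?_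
    refine (sum_le_sum (g := fun _ => (1 : ℝ)) ?_).trans (by simp)
    intro d hd
    have hd0 : (0 : ℝ) < d := by exact_mod_cast (mem_Ioc.1 hd).1
    rw [← mul_sub, abs_mul]
    have h1 : ((n / d : ℕ) : ℝ) ≤ n / d := Nat.cast_div_le
    have h2 : (n : ℝ) / d < (n / d : ℕ) + 1 := by
      rw [div_lt_iff₀ hd0]
      exact_mod_cast (mul_comm d _) ▸ Nat.lt_mul_div_succ n (mem_Ioc.1 hd).1
    have h3 : |(n : ℝ) / d - (n / d : ℕ)| ≤ 1 := abs_le.2 ⟨by linarith, by linarith⟩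
    calc _ ≤ (1 : ℝ) * 1 := mul_le_mul (abs_moebius_cast_le_one d) h3 (abs_nonneg _) zero_le_one
      _ = 1 := one_mul 1
  rw [sum_sub_distrib, hfloor] at hdiff
  have hn' : (1 : ℝ) ≤ n := by exact_mod_cast hn
  have hmul : ∑ d ∈ Ioc 0 n, (moebius d : ℝ) * (n / d) =
      n * ∑ d ∈ Ioc 0 n, (moebius d : ℝ) / d := by
    rw [mul_sum]
    exact sum_congr rfl fun d _ => by ring
  rw [hmul, abs_le] at hdiff
  rw [abs_le]
  constructor <;> nlinarith

lemma hasSum_moebius_div_sq :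
    HasSum (fun d : ℕ => (moebius d : ℝ) / (d : ℝ) ^ 2) (6 / Real.pi ^ 2) := by
  have hs : 1 < (2 : ℂ).re := by norm_num
  have h1 := LSeries_zeta_mul_Lseries_moebius hs
  rw [LSeries_zeta_eq_riemannZeta hs, riemannZeta_two] at h1
  have hpi : (Real.pi : ℂ) ≠ 0 := by exact_mod_cast Real.pi_ne_zero
  have hL : LSeries (fun n => ((moebius n : ℤ) : ℂ)) 2 = ((6 / Real.pi ^ 2 : ℝ) : ℂ) := by
    push_cast
    field_simp at h1 ⊢
    linear_combination h1
  have h2 := (LSeriesSummable_moebius_iff.2 hs).LSeriesHasSum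
  rw [hL] at h2
  unfold LSeriesHasSum at h2
  rw [← Complex.hasSum_ofReal]
  refine h2.congr_fun fun d => ?_
  rcases eq_or_ne d 0 with rfl | hd
  · simp
  · simp [LSeries.term_of_ne_zero hd]

lemma abs_sum_moebius_div_sq_sub_le {n : ℕ} (hn : 0 < n) :
    |(∑ d ∈ Ioc 0 n, (moebius d : ℝ) / (d : ℝ) ^ 2) - 6 / Real.pi ^ 2| ≤ (1 : ℝ) / n := by
  have hlim := hasSum_moebius_div_sq.tendsto_sum_nat.comp (Filter.tendsto_add_atTop_nat 1)
  refine le_of_tendsto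
    (hlim.const_sub (∑ d ∈ Ioc 0 n, (moebius d : ℝ) / (d : ℝ) ^ 2)).abs ?_
  filter_upwards [Filter.eventually_ge_atTop n] with M hM
  have hsplit : ∑ d ∈ range (M + 1), (moebius d : ℝ) / (d : ℝ) ^ 2 =
      ∑ d ∈ Ioc 0 n, (moebius d : ℝ) / (d : ℝ) ^ 2 +
        ∑ d ∈ Ioc n M, (moebius d : ℝ) / (d : ℝ) ^ 2 := by
    rw [sum_Ioc_consecutive _ (Nat.zero_le n) hM, Nat.range_succ_eq_Icc_zero,
      ← Ioc_insert_left (Nat.zero_le M), sum_insert (by simp)]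
    simp
  simp only [Function.comp_apply]
  rw [hsplit, sub_add_cancel_left, abs_neg]
  calc _ ≤ ∑ d ∈ Ioc n M, |(moebius d : ℝ) / (d : ℝ) ^ 2| := abs_sum_le_sum_abs _ _
    _ ≤ ∑ d ∈ Ioc n M, ((d : ℝ) ^ 2)⁻¹ := by
      refine sum_le_sum fun d _ => ?_
      rw [abs_div, abs_of_nonneg (sq_nonneg (d : ℝ)), div_eq_mul_inv]
      exact mul_le_of_le_one_left (by positivity) (abs_moebius_cast_le_one d)
    _ ≤ (n : ℝ)⁻¹ - (M : ℝ)⁻¹ := sum_Ioc_inv_sq_le_sub hn.ne' hM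
    _ ≤ 1 / n := by
      have : (0 : ℝ) ≤ (M : ℝ)⁻¹ := by positivity
      rw [one_div]
      linarith

lemma sum_totient_mul_sub (q N : ℝ) (n : ℕ) :
    ∑ h ∈ Ioc 0 n, (h.totient : ℝ) * (N / h - q) =
      ∑ d ∈ Ioc 0 n, (moebius d : ℝ) *
        (N / d * (n / d : ℕ) - q * ((n / d : ℕ) * ((n / d : ℕ) + 1) / 2)) := by
  calc _ = ∑ h ∈ Ioc 0 n, ∑ x ∈ h.divisorsAntidiagonal,
        (moebius x.1 : ℝ) * (N / x.1 - q * x.2) := by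
        refine sum_congr rfl fun h hh => ?_
        rw [totient_eq_sum_moebius (mem_Ioc.1 hh).1, sum_mul]
        refine sum_congr rfl fun x hx => ?_
        obtain ⟨rfl, hx0⟩ := Nat.mem_divisorsAntidiagonal.1 hx
        obtain ⟨h1, h2⟩ := mul_ne_zero_iff.1 hx0
        push_cast
        field_simp
    _ = ∑ d ∈ Ioc 0 n, ∑ m ∈ Ioc 0 (n / d), (moebius d : ℝ) * (N / d - q * m) :=
        sum_Ioc_sum_divisorsAntidiagonal (fun d m => (moebius d : ℝ) * (N / d - q * m)) n
    _ = _ := by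
        refine sum_congr rfl fun d _ => ?_
        rw [← mul_sum, sum_sub_distrib, ← mul_sum, sum_const, Nat.card_Ioc, nsmul_eq_mul]
        have gauss : ∀ k : ℕ, ∑ m ∈ Ioc 0 k, (m : ℝ) = k * (k + 1) / 2 := by
          intro k
          induction k with
          | zero => simp
          | succ k ih =>
            rw [sum_Ioc_succ_top (Nat.zero_le k), ih]
            push_cast
            ring
        rw [gauss]
        simp only [Nat.sub_zero]
        ring

lemma abs_sum_totient_mul_sub_le {n : ℕ} {q N : ℝ} (hn : 0 < n) (hq : 0 < q)
    (h1 : q * n ≤ N) (h2 : N < q * (n + 1)) :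
    |(∑ h ∈ Ioc 0 n, (h.totient : ℝ) * (N / h - q)) - 3 / Real.pi ^ 2 * N ^ 2 / q| ≤ 3 * N := by
  rw [sum_totient_mul_sub q N n]
  have hn' : (1 : ℝ) ≤ n := by exact_mod_cast hn
  have hN : 0 < N := by nlinarith
  have herr : |∑ d ∈ Ioc 0 n, ((moebius d : ℝ) *
        (N / d * (n / d : ℕ) - q * ((n / d : ℕ) * ((n / d : ℕ) + 1) / 2)) -
        (moebius d : ℝ) * (N ^ 2 / (2 * q) / d ^ 2 - N / 2 / d))| ≤ N := by
    refine (abs_sum_le_sum_abs _ _).trans ?_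
    refine (sum_le_sum (g := fun _ => q) ?_).trans (by simpa [mul_comm] using h1)
    intro d hd
    have hd0 : (0 : ℝ) < d := by exact_mod_cast (mem_Ioc.1 hd).1
    rw [← mul_sub, abs_mul]
    set k := n / d with hk
    have hk1 : (k : ℝ) * d ≤ n := by exact_mod_cast Nat.div_mul_le_self n d
    have hk2 : (n : ℝ) + 1 ≤ (k + 1) * d := by
      exact_mod_cast (mul_comm d _) ▸ Nat.lt_mul_div_succ n (mem_Ioc.1 hd).1
    obtain ⟨y, hy⟩ : ∃ y, y = N / (q * d) := ⟨_, rfl⟩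
    have hNy : N = q * d * y := by rw [hy]; field_simp
    have hky : (k : ℝ) ≤ y := by
      rw [hy, le_div_iff₀ (by positivity)]
      nlinarith
    have hyk : y ≤ k + 1 := by
      rw [hy, div_le_iff₀ (by positivity)]
      nlinarith
    have heq : N / d * k - q * (k * (k + 1) / 2) - (N ^ 2 / (2 * q) / d ^ 2 - N / 2 / d) =
        q * (((y - k) - (y - k) ^ 2) / 2) := by
      rw [hNy]
      field_simp
      ring
    rw [heq]
    have h3 : |q * (((y - k) - (y - k) ^ 2) / 2)| ≤ q := by
      rw [abs_mul, abs_of_pos hq]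
      refine mul_le_of_le_one_right hq.le (abs_le.2 ⟨?_, ?_⟩) <;> nlinarith
    calc _ ≤ 1 * q := mul_le_mul (abs_moebius_cast_le_one d) h3 (abs_nonneg _) zero_le_one
      _ = q := one_mul q
  have hmain : ∑ d ∈ Ioc 0 n, (moebius d : ℝ) * (N ^ 2 / (2 * q) / d ^ 2 - N / 2 / d) =
      N ^ 2 / (2 * q) * ∑ d ∈ Ioc 0 n, (moebius d : ℝ) / (d : ℝ) ^ 2 -
        N / 2 * ∑ d ∈ Ioc 0 n, (moebius d : ℝ) / d := by
    rw [mul_sum, mul_sum, ← sum_sub_distrib]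
    exact sum_congr rfl fun d _ => by ring
  rw [sum_sub_distrib, hmain] at herr
  have hM1 := abs_sum_moebius_div_le n
  have hM2 := abs_sum_moebius_div_sq_sub_le hn
  generalize ∑ d ∈ Ioc 0 n, (moebius d : ℝ) / (d : ℝ) ^ 2 = A at *
  generalize ∑ d ∈ Ioc 0 n, (moebius d : ℝ) / d = B at *
  generalize ∑ d ∈ Ioc 0 n, (moebius d : ℝ) *
        (N / d * (n / d : ℕ) - q * ((n / d : ℕ) * ((n / d : ℕ) + 1) / 2)) = S at *
  have hA : |N ^ 2 / (2 * q) * (A - 6 / Real.pi ^ 2)| ≤ N := by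
    rw [abs_mul, abs_of_pos (by positivity)]
    calc _ ≤ N ^ 2 / (2 * q) * (1 / n) := by gcongr
      _ ≤ N := by
        have : N ≤ 2 * q * n := by nlinarith
        rw [div_mul_div_comm, div_le_iff₀ (by positivity)]
        nlinarith
  have hB : |N / 2 * B| ≤ N := by
    rw [abs_mul, abs_of_pos (by positivity)]
    nlinarith
  have hsplit : S - 3 / Real.pi ^ 2 * N ^ 2 / q =
      (S - (N ^ 2 / (2 * q) * A - N / 2 * B)) + N ^ 2 / (2 * q) * (A - 6 / Real.pi ^ 2)
        - N / 2 * B := by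
    ring
  rw [hsplit]
  rw [abs_le] at *
  constructor <;> linarith [herr.1, herr.2, hA.1, hA.2, hB.1, hB.2]

lemma mem_farey {N : ℕ} (hN : 0 < N) {r : ℚ} :
    r ∈ farey N ↔ 0 ≤ r ∧ r ≤ 1 ∧ r.den ≤ N := by
  simp only [farey, mem_biUnion, mem_range, mem_image]
  constructor
  · rintro ⟨k, hk, h, hh, rfl⟩
    refine ⟨by positivity, div_le_one_of_le₀ (by exact_mod_cast Nat.lt_succ_iff.1 hh) (by simp), ?_⟩
    rcases Nat.eq_zero_or_pos k with rfl | hk0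
    · simpa using Nat.succ_le_of_lt hN
    · refine (Nat.le_of_dvd hk0 ?_).trans (Nat.lt_succ_iff.1 hk)
      have := Rat.den_dvd (h : ℤ) (k : ℤ)
      rw [Rat.divInt_eq_div] at this
      simp only [Int.cast_natCast] at this
      exact Int.natCast_dvd_natCast.1 this
  · rintro ⟨h0, h1, hd⟩
    have hnum : ((r.num.toNat : ℕ) : ℤ) = r.num := Int.toNat_of_nonneg (Rat.num_nonneg.2 h0)
    refine ⟨r.den, Nat.lt_succ_of_le hd, r.num.toNat, ?_, ?_⟩
    · have := Rat.num_le_denom_iff.2 h1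
      omega
    · have : ((r.num.toNat : ℕ) : ℚ) = r.num := by exact_mod_cast hnum
      rw [this, Rat.num_div_den]

lemma fareyPos_one_div {N q n : ℕ} (hq : 0 < q) (hN : 0 < N) (hn : N < q * (n + 1)) :
    fareyPos N (1 / (q : ℚ)) =
      ∑ h ∈ range (n + 1), #{k ∈ Icc (h * q) N | h.Coprime k} := by
  rw [← card_sigma, fareyPos]
  have hqQ : (0 : ℚ) < q := by exact_mod_cast hq
  have hpos : ∀ {h k : ℕ}, h * q ≤ k → h.Coprime k → 0 < k := by
    intro h k hle hcop
    rcases Nat.eq_zero_or_pos k with rfl | hk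
    · have := (Nat.coprime_zero_right h).1 hcop
      subst this
      omega
    · exact hk
  have hrat : ∀ {h k : ℕ}, 0 < k → h.Coprime k →
      ((h : ℚ) / k).num = h ∧ ((h : ℚ) / k).den = k := by
    intro h k hk hcop
    have h1 := Rat.num_div_eq_of_coprime (a := h) (b := k) (by exact_mod_cast hk) hcop
    have h2 := Rat.den_div_eq_of_coprime (a := h) (b := k) (by exact_mod_cast hk) hcop
    simp only [Int.cast_natCast] at h1 h2
    exact ⟨h1, Nat.cast_injective h2⟩
  refine card_bij' (fun r _ => ⟨r.num.toNat, r.den⟩) (fun p _ => (p.1 : ℚ) / p.2) ?_ ?_ ?_ ?_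
  · intro r hr
    rw [mem_filter, mem_farey hN] at hr
    obtain ⟨⟨h0, -, hd⟩, hle⟩ := hr
    have hnum : ((r.num.toNat : ℕ) : ℤ) = r.num := Int.toNat_of_nonneg (Rat.num_nonneg.2 h0)
    have hle' : r.num.toNat * q ≤ r.den := by
      rw [← Rat.num_div_den r, div_le_div_iff₀ (by exact_mod_cast r.den_pos) hqQ, one_mul] at hle
      zify
      rw [hnum]
      exact_mod_cast hle
    simp only [mem_sigma, mem_range, mem_filter, mem_Icc]
    refine ⟨?_, ⟨hle', hd⟩, ?_⟩
    · by_contra! hlt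
      nlinarith
    · have := r.reduced
      rwa [← hnum, Int.natAbs_natCast] at this
  · rintro ⟨h, k⟩ hp
    simp only [mem_sigma, mem_range, mem_filter, mem_Icc] at hp
    obtain ⟨-, ⟨hle, hkN⟩, hcop⟩ := hp
    have hk : 0 < k := hpos hle hcop
    have hhk : h ≤ k := (Nat.le_mul_of_pos_right h hq).trans hle
    rw [mem_filter, mem_farey hN]
    refine ⟨⟨by positivity, div_le_one_of_le₀ (by exact_mod_cast hhk) (by simp), ?_⟩, ?_⟩
    · rwa [(hrat hk hcop).2]
    · rw [div_le_div_iff₀ (by exact_mod_cast hk) hqQ, one_mul]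
      exact_mod_cast hle
  · intro r hr
    rw [mem_filter, mem_farey hN] at hr
    have hnum : ((r.num.toNat : ℕ) : ℤ) = r.num := Int.toNat_of_nonneg (Rat.num_nonneg.2 hr.1.1)
    have : ((r.num.toNat : ℕ) : ℚ) = r.num := by exact_mod_cast hnum
    simp only [this, Rat.num_div_den]
  · rintro ⟨h, k⟩ hp
    simp only [mem_sigma, mem_range, mem_filter, mem_Icc] at hp
    obtain ⟨-, ⟨hle, -⟩, hcop⟩ := hp
    obtain ⟨h1, h2⟩ := hrat (hpos hle hcop) hcop
    simp only [h1, h2, Int.toNat_natCast]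

lemma card_filter_coprime_Ico_mul (h a t : ℕ) :
    #{k ∈ Ico a (a + h * t) | h.Coprime k} = t * h.totient := by
  induction t with
  | zero => simp
  | succ t ih =>
    have hu : Ico a (a + h * (t + 1)) =
        Ico a (a + h * t) ∪ Ico (a + h * t) (a + h * t + h) := by
      rw [Ico_union_Ico_eq_Ico (by omega) (by omega), mul_add_one, add_assoc]
    rw [hu, filter_union, card_union_of_disjoint, ih, Nat.filter_coprime_Ico_eq_totient]
    · ring
    · exact disjoint_filter_filter (Ico_disjoint_Ico_consecutive _ _ _)

lemma card_filter_coprime_Icc_mul {h q m : ℕ} (hqm : q ≤ m) :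
    #{k ∈ Icc (h * q) (h * m) | h.Coprime k} =
      (m - q) * h.totient + if h = 1 then 1 else 0 := by
  have heq : h * m = h * q + h * (m - q) := by
    rw [← mul_add, Nat.add_sub_cancel' hqm]
  rw [← Ico_insert_right (Nat.mul_le_mul_left h hqm), filter_insert]
  have hc : h.Coprime (h * m) ↔ h = 1 := by
    rw [Nat.coprime_mul_iff_right, Nat.coprime_self]
    exact ⟨fun h => h.1, fun h => by simp [h]⟩
  simp only [hc]
  split_ifs with h1
  · rw [card_insert_of_notMem (by simp), heq, card_filter_coprime_Ico_mul]
  · rw [heq, card_filter_coprime_Ico_mul, add_zero]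

/-- there is `C > 0` such that for `N = lcm(1,…,i_max)`,
`1 ≤ i ≤ i_max` and `N/(i+1) < q ≤ N/i`, `| I_N(1/q) − (3/π²)·N²/q | ≤ C·N`. -/
theorem stmt_9 :
    ∃ C : ℝ, 0 < C ∧
      ∀ imax i q N : ℕ,
        1 ≤ imax → 1 ≤ i → i ≤ imax →
        N = lcmUpTo imax →
        (N : ℝ) / (i + 1) < q → (q : ℝ) ≤ (N : ℝ) / i →
        |(fareyPos N (1 / (q : ℚ)) : ℝ) - 3 / Real.pi ^ 2 * (N : ℝ) ^ 2 / q|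
          ≤ C * N := by
  refine ⟨5, by norm_num, ?_⟩
  intro imax i q N _ hi hile hN hlt hle
  have hN0 : 0 < N := by
    rw [hN, lcmUpTo, Nat.pos_iff_ne_zero, Ne, Finset.lcm_eq_zero_iff]
    simp
  have hdvd : ∀ h, 0 < h → h ≤ i → h ∣ N := fun h h0 h1 => by
    rw [hN]
    exact Finset.dvd_lcm (f := id) (mem_Icc.2 ⟨h0, h1.trans hile⟩)
  have hi0 : (0 : ℝ) < i := by exact_mod_cast hi
  have hq0R : (0 : ℝ) < q := lt_of_le_of_lt (by positivity) hlt
  have hq0 : 0 < q := by exact_mod_cast hq0R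
  rw [div_lt_iff₀ (by positivity)] at hlt
  rw [le_div_iff₀ hi0] at hle
  have hltN : N < q * (i + 1) := by exact_mod_cast hlt
  have hleN : q * i ≤ N := by exact_mod_cast hle
  have hterm : ∀ h ∈ Ioc 0 i, (#{k ∈ Icc (h * q) N | h.Coprime k} : ℝ) =
      h.totient * ((N : ℝ) / h - q) + if h = 1 then 1 else 0 := by
    intro h hh
    obtain ⟨h0, h1⟩ := mem_Ioc.1 hh
    obtain ⟨m, rfl⟩ := hdvd h h0 h1
    have hqm : q ≤ m := by
      refine Nat.le_of_mul_le_mul_left ?_ h0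
      nlinarith
    rw [card_filter_coprime_Icc_mul hqm]
    have h0' : (h : ℝ) ≠ 0 := by exact_mod_cast h0.ne'
    push_cast [Nat.cast_sub hqm]
    rw [mul_div_cancel_left₀ _ h0']
    ring
  have hzero : #{k ∈ Icc (0 * q) N | Nat.Coprime 0 k} = 1 := by
    have : {k ∈ Icc (0 * q) N | Nat.Coprime 0 k} = {1} := by
      ext k
      simp only [mem_filter, mem_Icc, Nat.coprime_zero_left, mem_singleton]
      omega
    rw [this, card_singleton]
  have hpos : (fareyPos N (1 / (q : ℚ)) : ℝ) =
      2 + ∑ h ∈ Ioc 0 i, (h.totient : ℝ) * ((N : ℝ) / h - q) := by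
    rw [fareyPos_one_div hq0 hN0 hltN, Nat.range_succ_eq_Icc_zero,
      ← Ioc_insert_left (Nat.zero_le i), sum_insert (by simp), hzero]
    push_cast
    rw [sum_congr rfl hterm, sum_add_distrib, sum_ite_eq' (Ioc 0 i) 1,
      if_pos (mem_Ioc.2 ⟨one_pos, hi⟩)]
    ring
  have hmain := abs_sum_totient_mul_sub_le hi hq0R hle hlt
  have hN1 : (1 : ℝ) ≤ N := by exact_mod_cast hN0
  rw [hpos, add_sub_assoc]
  calc _ ≤ |(2 : ℝ)| + _ := abs_add_le _ _
    _ ≤ 2 + 3 * N := by rw [abs_two]; gcongr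
    _ ≤ 5 * N := by linarith
end
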